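/- Every graph G containing a geodesic cycle of length k has tree-width at least k/ℓ(G), where ℓ(G) is the smallest ℓ such that cycles of length at most ℓ generate the cycle space of G. -/

import Mathlib

open SimpleGraph

universe u

/-- `x` and `y` are joined by a walk in `G` all of whose vertices lie in `S`. -/
def ConnIn {V : Type u} (G : SimpleGraph V) (S : Set V) (x y : V) : Prop :=
  ∃ p : G.Walk x y, ∀ v ∈ p.support, v ∈ S

/-- `S` is a (nonempty) connected vertex set of `G`, i.e. `G[S]` is connected. -/
def IsConnSet {V : Type u} (G : SimpleGraph V) (S : Set V) : Prop :=
  S.Nonempty ∧ ∀ x ∈ S, ∀ y ∈ S, ConnIn G S x y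

/-- A tree-decomposition of `G` over the tree `T`. -/
structure TreeDecomp {V ι : Type u} (G : SimpleGraph V) (T : SimpleGraph ι) where
  isTree : T.IsTree
  bag : ι → Set V
  exists_bag : ∀ v : V, ∃ t, v ∈ bag t
  exists_bag_adj : ∀ ⦃u v : V⦄, G.Adj u v → ∃ t, u ∈ bag t ∧ v ∈ bag t
  bag_sep : ∀ ⦃t₁ t₃ : ι⦄ (p : T.Walk t₁ t₃), p.IsPath → ∀ t₂ ∈ p.support,
      bag t₁ ∩ bag t₃ ⊆ bag t₂

/-- The union of the bags `B u` over `u ∈ A`. -/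
def unionBags {V ι : Type u} (B : ι → Set V) (A : Set ι) : Set V := ⋃ u ∈ A, B u

/-- `s` is a descendant of `t` in the tree `T` rooted at `r`:
`t` lies on the (unique) `r`–`s` path. -/
def Desc {ι : Type u} (T : SimpleGraph ι) (r t s : ι) : Prop :=
  ∃ p : T.Walk r s, p.IsPath ∧ t ∈ p.support

/-- The set of descendants of `t` (the subtree `T_t`). -/
def descSet {ι : Type u} (T : SimpleGraph ι) (r t : ι) : Set ι := {s | Desc T r t s}

/-- `s` is a child of `t` in the tree `T` rooted at `r`. -/
def IsChild {ι : Type u} (T : SimpleGraph ι) (r t s : ι) : Prop :=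
  T.Adj t s ∧ Desc T r t s

/-- The vertex set of the component of `t₁` in `T` minus the edge `t₁t₂`. -/
def Side {ι : Type u} (T : SimpleGraph ι) (t₁ t₂ : ι) : Set ι :=
  {u | ∃ p : T.Walk u t₁, p.IsPath ∧ t₂ ∉ p.support}

/-- The family of bags `B` is stable: for every tree edge `t₁t₂`, both sides
induce connected subgraphs of `G`. -/
def StableBags {V ι : Type u} (G : SimpleGraph V) (T : SimpleGraph ι) (B : ι → Set V) : Prop :=
  ∀ ⦃t₁ t₂ : ι⦄, T.Adj t₁ t₂ → IsConnSet G (unionBags B (Side T t₁ t₂))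

def TreeDecomp.Stable {V ι : Type u} {G : SimpleGraph V} {T : SimpleGraph ι}
    (td : TreeDecomp G T) : Prop :=
  StableBags G T td.bag

/-- `P` is a `t`-admissible path (w.r.t. the root `r` and bags `B`): a shortest
path lying in `V_{T_t}` joining two distinct components of `G[B t]`. -/
structure IsAdmissible {V ι : Type u} (G : SimpleGraph V) (T : SimpleGraph ι)
    (B : ι → Set V) (r t : ι) {x y : V} (P : G.Walk x y) : Prop where
  isPath : P.IsPath
  support_sub : ∀ v ∈ P.support, v ∈ unionBags B (descSet T r t)
  fst_mem : x ∈ B t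
  snd_mem : y ∈ B t
  not_conn : ¬ ConnIn G (B t) x y
  minimal : ∀ ⦃x' y' : V⦄ (Q : G.Walk x' y'), Q.IsPath →
      (∀ v ∈ Q.support, v ∈ unionBags B (descSet T r t)) →
      x' ∈ B t → y' ∈ B t → ¬ ConnIn G (B t) x' y' → P.length ≤ Q.length

/-- The updated bags obtained by adding the path `P` as in `(*)`:
`W_u = V_u ∪ (V(P) ∩ V_{T_u})` for descendants `u` of `t`, and `W_u = V_u` otherwise. -/
def updatedBag {V ι : Type u} (T : SimpleGraph ι) (B : ι → Set V) (r t : ι)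
    {G : SimpleGraph V} {x y : V} (P : G.Walk x y) (u : ι) : Set V :=
  B u ∪ {v | Desc T r t u ∧ v ∈ P.support ∧ v ∈ unionBags B (descSet T r u)}

/-- The tree-width of `G`: the least `k` such that `G` has a tree-decomposition
all of whose bags have at most `k + 1` vertices. -/
noncomputable def treewidth {V : Type u} (G : SimpleGraph V) : ℕ :=
  sInf {k | ∃ (ι : Type u) (T : SimpleGraph ι) (td : TreeDecomp G T),
    ∀ t, (td.bag t).ncard ≤ k + 1}

/-- A tree-decomposition is connected if every bag is a connected vertex set. -/
def TreeDecomp.IsConn {V ι : Type u} {G : SimpleGraph V} {T : SimpleGraph ι}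
    (td : TreeDecomp G T) : Prop :=
  ∀ t, IsConnSet G (td.bag t)

/-- The connected tree-width of `G`. -/
noncomputable def ctw {V : Type u} (G : SimpleGraph V) : ℕ :=
  sInf {k | ∃ (ι : Type u) (T : SimpleGraph ι) (td : TreeDecomp G T),
    td.IsConn ∧ ∀ t, (td.bag t).ncard ≤ k + 1}

/-- The weak connected tree-width of `G`: the least `k` such that `G` has a
tree-decomposition each of whose bags is contained in a connected set of at
most `k + 1` vertices. -/
noncomputable def wctw {V : Type u} (G : SimpleGraph V) : ℕ :=
  sInf {k | ∃ (ι : Type u) (T : SimpleGraph ι) (td : TreeDecomp G T),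
    ∀ t, ∃ X, td.bag t ⊆ X ∧ IsConnSet G X ∧ X.ncard ≤ k + 1}

/-- The characteristic vector over GF(2) of the edge set of a walk. -/
noncomputable def walkChar {V : Type u} {G : SimpleGraph V} {x y : V}
    (p : G.Walk x y) : Sym2 V → ZMod 2 :=
  fun e => by classical exact if e ∈ p.edges then 1 else 0

/-- The characteristic vectors of the cycles of `G` of length at most `ℓ`. -/
def cycleChars {V : Type u} (G : SimpleGraph V) (ℓ : ℕ) : Set (Sym2 V → ZMod 2) :=
  {f | ∃ (v : V) (p : G.Walk v v), p.IsCycle ∧ p.length ≤ ℓ ∧ f = walkChar p}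

/-- The cycles of length at most `ℓ` generate the cycle space of `G` over GF(2). -/
def GeneratesLE {V : Type u} (G : SimpleGraph V) (ℓ : ℕ) : Prop :=
  ∀ ⦃v : V⦄ (p : G.Walk v v), p.IsCycle →
    walkChar p ∈ Submodule.span (ZMod 2) (cycleChars G ℓ)

/-- `ℓ(G)`: the least `ℓ` such that the cycles of length at most `ℓ`
generate the cycle space of `G`. -/
noncomputable def ellGraph {V : Type u} (G : SimpleGraph V) : ℕ :=
  sInf {ℓ | GeneratesLE G ℓ}

/-- `Γ` is a set of cycles of `G` generating its cycle space over GF(2). -/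
def GeneratesSet {V : Type u} (G : SimpleGraph V) (Γ : Set (Σ v : V, G.Walk v v)) : Prop :=
  (∀ c ∈ Γ, c.2.IsCycle) ∧
  ∀ ⦃v : V⦄ (p : G.Walk v v), p.IsCycle →
    walkChar p ∈ Submodule.span (ZMod 2) {f | ∃ c ∈ Γ, f = walkChar c.2}

/-- A bramble: a collection of connected vertex sets, any two of which have
connected union. -/
def IsBramble {V : Type u} (G : SimpleGraph V) (B : Set (Set V)) : Prop :=
  (∀ S ∈ B, IsConnSet G S) ∧ ∀ S ∈ B, ∀ S' ∈ B, IsConnSet G (S ∪ S')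

/-- `X` is a connected cover of the bramble `B`. -/
def IsConnCover {V : Type u} (G : SimpleGraph V) (B : Set (Set V)) (X : Set V) : Prop :=
  IsConnSet G X ∧ ∀ S ∈ B, (X ∩ S).Nonempty

/-- The connected order of a bramble: the least size of a connected cover. -/
noncomputable def connOrder {V : Type u} (G : SimpleGraph V) (B : Set (Set V)) : ℕ :=
  sInf {n | ∃ X, IsConnCover G B X ∧ X.ncard = n}

/-- The maximum connected order of a bramble of `G`. -/
noncomputable def cbn {V : Type u} (G : SimpleGraph V) : ℕ :=
  sSup {n | ∃ B, IsBramble G B ∧ connOrder G B = n}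

/-- A geodesic cycle: a cycle containing a shortest `G`-path between any two
of its vertices. -/
def IsGeodesicCycle {V : Type u} (G : SimpleGraph V) {v : V} (p : G.Walk v v) : Prop :=
  p.IsCycle ∧ ∀ x ∈ p.support, ∀ y ∈ p.support,
    ∃ q : G.Walk x y, q.length = G.dist x y ∧ ∀ e ∈ q.edges, e ∈ p.edges

/-- The graph obtained from `K_n` by subdividing every edge exactly `k` times:
the edge between `i < j` is replaced by the path
`i, ((i,j),0), ((i,j),1), …, ((i,j),k-1), j`. -/
def subK (n k : ℕ) : SimpleGraph (Fin n ⊕ ({p : Fin n × Fin n // p.1 < p.2} × Fin k)) :=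
  SimpleGraph.fromRel fun u v =>
    match u, v with
    | Sum.inl i, Sum.inl j => i < j ∧ k = 0
    | Sum.inl i, Sum.inr (e, c) =>
        (e.val.1 = i ∧ (c : ℕ) = 0) ∨ (e.val.2 = i ∧ (c : ℕ) = k - 1)
    | Sum.inr (e, c), Sum.inr (e', c') => e = e' ∧ (c' : ℕ) = (c : ℕ) + 1
    | _, _ => False

namespace ConnIn

variable {V : Type u} {G : SimpleGraph V} {S S' : Set V} {x y z : V}

lemma refl (hx : x ∈ S) : ConnIn G S x x := ⟨.nil, by simpa⟩

lemma symm (h : ConnIn G S x y) : ConnIn G S y x := by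
  obtain ⟨p, hp⟩ := h
  exact ⟨p.reverse, by simpa using hp⟩

lemma trans (h : ConnIn G S x y) (h' : ConnIn G S y z) : ConnIn G S x z := by
  obtain ⟨p, hp⟩ := h
  obtain ⟨q, hq⟩ := h'
  refine ⟨p.append q, fun v hv => ?_⟩
  rcases (Walk.mem_support_append_iff p q).1 hv with h | h
  exacts [hp v h, hq v h]

lemma mono (hS : S ⊆ S') (h : ConnIn G S x y) : ConnIn G S' x y := by
  obtain ⟨p, hp⟩ := h
  exact ⟨p, fun v hv => hS (hp v hv)⟩

lemma left_mem (h : ConnIn G S x y) : x ∈ S := by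
  obtain ⟨p, hp⟩ := h
  exact hp _ p.start_mem_support

lemma right_mem (h : ConnIn G S x y) : y ∈ S := h.symm.left_mem

lemma of_adj (h : G.Adj x y) (hx : x ∈ S) (hy : y ∈ S) : ConnIn G S x y :=
  ⟨h.toWalk, by simp [hx, hy]⟩

/-- A connected component of `G[S]` is connected. -/
lemma component (a : V) :
    ∀ x ∈ {v | ConnIn G S a v}, ∀ y ∈ {v | ConnIn G S a v},
      ConnIn G {v | ConnIn G S a v} x y := by
  classical
  have key : ∀ y, ConnIn G S a y → ConnIn G {v | ConnIn G S a v} a y := by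
    rintro y ⟨p, hp⟩
    refine ⟨p, fun v hv => ⟨p.takeUntil v hv, fun w hw => ?_⟩⟩
    exact hp w (p.support_takeUntil_subset_support hv hw)
  exact fun x hx y hy => (key x hx).symm.trans (key y hy)

end ConnIn

section WalkSum

variable {V : Type u} {G : SimpleGraph V} {A : Type*} [AddCommMonoid A]

/-- The sum of the values of `φ` over the edges of a walk. -/
def walkSum (φ : Sym2 V → A) {x y : V} (p : G.Walk x y) : A := (p.edges.map φ).sum

@[simp] lemma walkSum_nil (φ : Sym2 V → A) (x : V) :
    walkSum φ (Walk.nil : G.Walk x x) = 0 := by simp [walkSum]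

@[simp] lemma walkSum_cons (φ : Sym2 V → A) {x y z : V} (h : G.Adj x y) (p : G.Walk y z) :
    walkSum φ (p.cons h) = φ s(x, y) + walkSum φ p := by simp [walkSum]

@[simp] lemma walkSum_append (φ : Sym2 V → A) {x y z : V} (p : G.Walk x y) (q : G.Walk y z) :
    walkSum φ (p.append q) = walkSum φ p + walkSum φ q := by simp [walkSum]

@[simp] lemma walkSum_reverse (φ : Sym2 V → A) {x y : V} (p : G.Walk x y) :
    walkSum φ p.reverse = walkSum φ p := by simp [walkSum]

lemma walkSum_eq_zero {φ : Sym2 V → A} {x y : V} (p : G.Walk x y)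
    (h : ∀ e ∈ p.edges, φ e = 0) : walkSum φ p = 0 := by
  refine List.sum_eq_zero fun a ha => ?_
  obtain ⟨e, he, rfl⟩ := List.mem_map.1 ha
  exact h e he

lemma walkSum_bypass [DecidableEq V] {φ : Sym2 V → ZMod 2}
    (hφ : ∀ (v : V) (p : G.Walk v v), p.IsCycle → walkSum φ p = 0) {x y : V} (p : G.Walk x y) :
    walkSum φ p.bypass = walkSum φ p := by
  induction p with
  | nil => simp [Walk.bypass]
  | @cons u v w h p ih =>
    rw [walkSum_cons, ← ih, Walk.bypass]
    by_cases hs : u ∈ p.bypass.support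
    · simp only [hs, dite_true]
      have hpath : (p.bypass.takeUntil u hs).IsPath := p.bypass_isPath.takeUntil hs
      have hcycle : φ s(u, v) + walkSum φ (p.bypass.takeUntil u hs) = 0 := by
        by_cases he : s(u, v) ∈ (p.bypass.takeUntil u hs).edges
        · rw [hpath.eq_adj_toWalk_of_mem_edges (Sym2.eq_swap ▸ he)]
          simp [Sym2.eq_swap (a := v), CharTwo.add_self_eq_zero]
        · rw [← walkSum_cons (h := h)]
          exact hφ _ _ ((Walk.cons_isCycle_iff _ _).2 ⟨hpath, he⟩)
      conv_rhs => rw [← p.bypass.take_spec hs, walkSum_append, ← add_assoc, hcycle, zero_add]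
    · simp [hs]

/-- A function on edges whose sum over each cycle vanishes has equal sums over any two walks
with the same ends. -/
lemma walkSum_eq_of_isCycle {φ : Sym2 V → ZMod 2}
    (hφ : ∀ (v : V) (p : G.Walk v v), p.IsCycle → walkSum φ p = 0) {x y : V}
    (p q : G.Walk x y) : walkSum φ p = walkSum φ q := by
  classical
  have h := walkSum_bypass hφ (p.append q.reverse)
  have hnil : (p.append q.reverse).bypass = .nil :=
    (Walk.isPath_iff_nil.1 (Walk.bypass_isPath _)).eq_nil
  rw [hnil, walkSum_nil, walkSum_append, walkSum_reverse] at h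
  exact CharTwo.add_eq_zero.1 h.symm

lemma walkSum_eq_sum_walkChar [Fintype (Sym2 V)] (φ : Sym2 V → ZMod 2) {x y : V}
    {p : G.Walk x y} (hp : p.IsTrail) : walkSum φ p = ∑ e, walkChar p e * φ e := by
  classical
  rw [walkSum, ← List.sum_toFinset _ hp.edges_nodup, ← Finset.sum_filter_add_sum_filter_not
    Finset.univ (· ∈ p.edges)]
  rw [Finset.sum_eq_zero (s := Finset.univ.filter (· ∉ p.edges)), add_zero]
  · refine Finset.sum_congr (by ext; simp) fun e he => ?_
    have : e ∈ p.edges := by simpa using he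
    simp [walkChar, this]
  · intro e he
    have : e ∉ p.edges := by simpa using he
    simp [walkChar, this]

lemma walkSum_isCycle_eq_zero [Finite V] {ℓ : ℕ} (hℓ : GeneratesLE G ℓ) {φ : Sym2 V → ZMod 2}
    (hφ : ∀ (v : V) (p : G.Walk v v), p.IsCycle → p.length ≤ ℓ → walkSum φ p = 0)
    (v : V) (p : G.Walk v v) (hp : p.IsCycle) : walkSum φ p = 0 := by
  classical
  have := Fintype.ofFinite V
  let L : (Sym2 V → ZMod 2) →ₗ[ZMod 2] ZMod 2 :=
    { toFun := fun f => ∑ e, f e * φ e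
      map_add' := fun f g => by simp [add_mul, Finset.sum_add_distrib]
      map_smul' := fun a f => by simp [mul_assoc, Finset.mul_sum] }
  have hle : Submodule.span (ZMod 2) (cycleChars G ℓ) ≤ LinearMap.ker L := by
    refine Submodule.span_le.2 ?_
    rintro _ ⟨w, q, hq, hql, rfl⟩
    exact (walkSum_eq_sum_walkChar φ hq.isTrail).symm.trans (hφ w q hq hql)
  exact (walkSum_eq_sum_walkChar φ hp.isTrail).trans (hle (hℓ p hp))

end WalkSum

section Separation

variable {V : Type u} {G : SimpleGraph V}

/-- If each cycle in a set generating the cycle space avoids `S₁` or `S₂`, then two vertices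
separated neither by `S₁` nor by `S₂` are not separated by `S₁ ∪ S₂`. -/
lemma ConnIn.compl_union [Finite V] {ℓ : ℕ} (hℓ : GeneratesLE G ℓ) {S₁ S₂ : Set V}
    (hcyc : ∀ (v : V) (p : G.Walk v v), p.IsCycle → p.length ≤ ℓ →
      (∀ x ∈ p.support, x ∈ S₁ᶜ) ∨ ∀ x ∈ p.support, x ∈ S₂ᶜ)
    {a b : V} (h₁ : ConnIn G S₁ᶜ a b) (h₂ : ConnIn G S₂ᶜ a b) :
    ConnIn G (S₁ ∪ S₂)ᶜ a b := by
  classical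
  by_contra hab
  set K : Set V := {v | ConnIn G (S₁ ∪ S₂)ᶜ a v} with hK
  have haS : a ∈ (S₁ ∪ S₂)ᶜ := fun h => h.elim h₁.left_mem h₂.left_mem
  have haK : a ∈ K := ConnIn.refl haS
  have hKS : ∀ x ∈ K, x ∉ S₁ := fun x hx h => hx.right_mem (.inl h)
  have hKadj : ∀ x y, G.Adj x y → x ∈ K → y ∉ S₁ → y ∉ S₂ → y ∈ K := fun x y hxy hx h h' =>
    ConnIn.trans hx (.of_adj hxy hx.right_mem (fun hy => hy.elim h h'))
  let φ : Sym2 V → ZMod 2 := fun e => if ∃ x ∈ K, ∃ y ∈ S₁, e = s(x, y) then 1 else 0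
  have hφ₁ : ∀ {x y : V} (p : G.Walk x y), (∀ v ∈ p.support, v ∈ S₁ᶜ) → walkSum φ p = 0 := by
    intro x y p hp
    refine walkSum_eq_zero p fun e he => if_neg ?_
    rintro ⟨u, -, w, hw, rfl⟩
    exact hp w (p.snd_mem_support_of_mem_edges he) hw
  let χ : V → ZMod 2 := fun v => if v ∈ K then 1 else 0
  have hφ₂ : ∀ {x y : V} (p : G.Walk x y), (∀ v ∈ p.support, v ∈ S₂ᶜ) →
      walkSum φ p = χ x + χ y := by
    intro x y p
    induction p with
    | nil => simp [CharTwo.add_self_eq_zero]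
    | @cons u v w h p ih =>
      intro hp
      simp only [Walk.support_cons, List.mem_cons, forall_eq_or_imp] at hp
      have hu : u ∉ S₂ := hp.1
      have hv : v ∉ S₂ := hp.2 v p.start_mem_support
      have hedge : φ s(u, v) = χ u + χ v := by
        have hiff : (∃ x ∈ K, ∃ y ∈ S₁, s(u, v) = s(x, y)) ↔
            (u ∈ K ∧ v ∈ S₁) ∨ (v ∈ K ∧ u ∈ S₁) := by
          constructor
          · rintro ⟨x, hx, y, hy, he⟩
            rcases Sym2.eq_iff.1 he with ⟨rfl, rfl⟩ | ⟨rfl, rfl⟩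
            exacts [.inl ⟨hx, hy⟩, .inr ⟨hx, hy⟩]
          · rintro (⟨hx, hy⟩ | ⟨hx, hy⟩)
            exacts [⟨u, hx, v, hy, rfl⟩, ⟨v, hx, u, hy, Sym2.eq_swap⟩]
        have h1 := hKadj u v h
        have h2 := hKadj v u h.symm
        have h3 := hKS u
        have h4 := hKS v
        simp only [φ, χ, hiff]
        by_cases huK : u ∈ K <;> by_cases hvK : v ∈ K <;> simp_all [CharTwo.add_self_eq_zero]
      rw [walkSum_cons, hedge, ih hp.2, add_assoc, ← add_assoc (χ v),
        CharTwo.add_self_eq_zero, zero_add]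
  have hzero : ∀ (v : V) (p : G.Walk v v), p.IsCycle → walkSum φ p = 0 := by
    refine walkSum_isCycle_eq_zero hℓ fun v p hp hpl => ?_
    rcases hcyc v p hp hpl with h | h
    · exact hφ₁ p h
    · rw [hφ₂ p h, CharTwo.add_self_eq_zero]
  obtain ⟨P, hP⟩ := h₁
  obtain ⟨Q, hQ⟩ := h₂
  have := walkSum_eq_of_isCycle hzero P Q
  rw [hφ₁ P hP, hφ₂ Q hQ] at this
  have hbK : b ∉ K := hab
  simp [χ, haK, hbK] at this

/-- Two vertices on a common closed walk of length at most `ℓ` are joined by a walk of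
length at most `ℓ / 2`. -/
lemma exists_walk_two_mul_length_le {v x y : V} (p : G.Walk v v) (hx : x ∈ p.support)
    (hy : y ∈ p.support) : ∃ w : G.Walk x y, 2 * w.length ≤ p.length := by
  classical
  have hy' : y ∈ (p.rotate x hx).support := (Walk.mem_support_rotate_iff ..).2 hy
  have hlen := congrArg Walk.length ((p.rotate x hx).take_spec hy')
  rw [Walk.length_append, Walk.length_rotate] at hlen
  rcases le_total ((p.rotate x hx).takeUntil y hy').length
    ((p.rotate x hx).dropUntil y hy').length with h | h
  · exact ⟨(p.rotate x hx).takeUntil y hy', by omega⟩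
  · exact ⟨((p.rotate x hx).dropUntil y hy').reverse, by rw [Walk.length_reverse]; omega⟩

/-- If a finite set cannot be split into two parts at distance more than `ℓ / 2`, then it lies on
a short closed walk. -/
lemma exists_closed_walk_of_not_split {ℓ : ℕ} (S : Finset V) (hne : S.Nonempty)
    (hS : ∀ S' ⊂ S, S'.Nonempty → ∃ x ∈ S', ∃ y ∈ S, y ∉ S' ∧ ∃ w : G.Walk x y, 2 * w.length ≤ ℓ) :
    ∃ (b : V) (w : G.Walk b b), w.length ≤ ℓ * (S.card - 1) ∧ ∀ x ∈ S, x ∈ w.support := by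
  classical
  have key : ∀ n, 1 ≤ n → n ≤ S.card → ∃ S' ⊆ S, S'.card = n ∧
      ∃ (b : V) (w : G.Walk b b), w.length ≤ ℓ * (n - 1) ∧ ∀ x ∈ S', x ∈ w.support := by
    intro n hn
    induction n, hn using Nat.le_induction with
    | base =>
      intro _
      obtain ⟨b, hb⟩ := hne
      exact ⟨{b}, by simpa, by simp, b, .nil, by simp, by simp⟩
    | succ n hn ih =>
      intro hcard
      obtain ⟨S', hS', hcard', b, w, hw, hmem⟩ := ih (by omega)
      have hss : S' ⊂ S := hS'.ssubset_of_ne (by rintro rfl; omega)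
      obtain ⟨x, hx, y, hy, hyS', e, he⟩ := hS S' hss (Finset.card_pos.1 (by omega))
      refine ⟨insert y S', Finset.insert_subset hy hS', by
        rw [Finset.card_insert_of_notMem hyS', hcard'], x,
        (w.rotate x (hmem x hx)).append (e.append e.reverse), ?_, ?_⟩
      · simp only [Walk.length_append, Walk.length_rotate, Walk.length_reverse]
        obtain ⟨m, rfl⟩ : ∃ m, n = m + 1 := ⟨n - 1, by omega⟩
        simp only [Nat.add_sub_cancel] at hw ⊢
        rw [Nat.mul_succ]
        omega
      · intro z hz
        rw [Walk.mem_support_append_iff, Walk.mem_support_append_iff]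
        rcases Finset.mem_insert.1 hz with rfl | hz
        · exact .inr (.inl e.end_mem_support)
        · exact .inl ((Walk.mem_support_rotate_iff ..).2 (hmem z hz))
  obtain ⟨S', hS', hcard, h⟩ := key S.card hne.card_pos le_rfl
  rwa [Finset.eq_of_subset_of_card_le hS' hcard.ge] at h

end Separation

/-- A periodic parametrization `c` of a geodesic cycle of length `k` in `G`. -/
structure IsGeodesicParam {V : Type u} (G : SimpleGraph V) (k : ℕ) (c : ℕ → V) : Prop where
  three_le : 3 ≤ k
  periodic : ∀ i, c (i + k) = c i
  inj : ∀ i j, c i = c j → i ≡ j [MOD k]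
  adj : ∀ i, G.Adj (c i) (c (i + 1))
  geodesic : ∀ i d, d ≤ k → ∀ w : G.Walk (c i) (c (i + d)), min d (k - d) ≤ w.length

lemma IsGeodesicCycle.exists_param {V : Type u} {G : SimpleGraph V} {v : V} {p : G.Walk v v}
    (hp : IsGeodesicCycle G p) : ∃ c, IsGeodesicParam G p.length c := by
  obtain ⟨hcyc, hgeo⟩ := hp
  set k := p.length with hk
  have h3 : 3 ≤ k := hcyc.three_le_length
  set c : ℕ → V := fun i => p.getVert (i % k) with hc
  have hlt : ∀ i, i % k < k := fun i => Nat.mod_lt _ (by omega)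
  have hsucc : ∀ i, i < k → c i = p.getVert i ∧ c (i + 1) = p.getVert (i + 1) := by
    intro i hi
    refine ⟨by simp [hc, Nat.mod_eq_of_lt hi], ?_⟩
    rcases eq_or_lt_of_le (Nat.succ_le_of_lt hi) with h | h
    · have h' : i + 1 = k := h
      simp [hc, h', hk]
    · simp [hc, Nat.mod_eq_of_lt h]
  have hper : ∀ i, c (i + k) = c i := fun i => by simp [hc]
  have hmod : ∀ i, c (i % k) = c i := fun i => by simp [hc]
  have hmod1 : ∀ i, c (i % k + 1) = c (i + 1) := fun i => by simp [hc]
  have hinj : ∀ i j, c i = c j → i ≡ j [MOD k] := by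
    intro i j hij
    exact hcyc.getVert_injOn' (by have := hlt i; simp; omega) (by have := hlt j; simp; omega) hij
  have hwalk : ∀ {x y : V} (q : G.Walk x y), (∀ e ∈ q.edges, e ∈ p.edges) → ∀ i j,
      x = c i → y = c j → ∃ z : ℤ, z.natAbs ≤ q.length ∧ (j : ℤ) ≡ i + z [ZMOD k] := by
    intro x y q
    induction q with
    | nil =>
      intro _ i j hi hj
      refine ⟨0, by simp, ?_⟩
      simpa using (Int.natCast_modEq_iff.2 (hinj i j (hi.symm.trans hj))).symm
    | @cons a b d h q ih =>
      intro hq i j hi hj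
      simp only [Walk.edges_cons, List.mem_cons, forall_eq_or_imp] at hq
      obtain ⟨m, hm, hme⟩ := (p.mk_mem_edges_iff_exists).1 hq.1
      rw [← (hsucc m hm).1, ← (hsucc m hm).2] at hme
      rcases Sym2.eq_iff.1 hme with ⟨h1, h2⟩ | ⟨h1, h2⟩
      · obtain ⟨z, hz, hzj⟩ := ih hq.2 (m + 1) j h2.symm hj
        have hmi := Int.natCast_modEq_iff.2 (hinj m i (h1.trans hi))
        refine ⟨z + 1, by simp only [Walk.length_cons]; omega, hzj.trans ?_⟩
        have := hmi.add_right (1 + z)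
        push_cast
        convert this using 1 <;> ring
      · obtain ⟨z, hz, hzj⟩ := ih hq.2 m j h1.symm hj
        have hmi := Int.natCast_modEq_iff.2 (hinj (m + 1) i (h2.trans hi))
        refine ⟨z - 1, by simp only [Walk.length_cons]; omega, hzj.trans ?_⟩
        have := hmi.add_right (z - 1)
        push_cast at this
        convert this using 1
        ring
  refine ⟨c, h3, hper, hinj, fun i => ?_, fun i d hd w => ?_⟩
  · rw [← hmod i, ← hmod1 i, (hsucc _ (hlt i)).1, (hsucc _ (hlt i)).2]
    exact p.adj_getVert_succ (hlt i)
  · obtain ⟨q, hq, hqe⟩ := hgeo (c i) (p.getVert_mem_support _) (c (i + d))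
      (p.getVert_mem_support _)
    obtain ⟨z, hz, hzj⟩ := hwalk q hqe i (i + d) rfl rfl
    have hle : q.length ≤ w.length := hq ▸ dist_le w
    obtain ⟨m, hm⟩ := hzj.symm.dvd
    have hz' : (d : ℤ) = z + k * m := by push_cast at hm; linarith
    rcases le_or_gt m 0 with h | h
    · have : (k : ℤ) * m ≤ 0 := mul_nonpos_of_nonneg_of_nonpos (by positivity) h
      omega
    · have : (k : ℤ) ≤ k * m := le_mul_of_one_le_right (by positivity) h
      omega

namespace IsGeodesicParam

variable {V : Type u} {G : SimpleGraph V} {k : ℕ} {c : ℕ → V}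

lemma map_mod (hc : IsGeodesicParam G k c) (i : ℕ) : c (i % k) = c i :=
  Function.Periodic.map_mod_nat hc.periodic i

lemma exists_shift (hc : IsGeodesicParam G k c) (s i : ℕ) :
    ∃ r < k, c i = c (s + r) := by
  have hk : 0 < k := by have := hc.three_le; omega
  refine ⟨(i + k * s - s) % k, Nat.mod_lt _ hk, ?_⟩
  have hle : s ≤ k * s := Nat.le_mul_of_pos_left s hk
  rw [← hc.map_mod (s + _), Nat.add_mod_mod, Nat.add_sub_of_le (by omega),
    Nat.add_mul_mod_self_left, hc.map_mod]

lemma card_image (hc : IsGeodesicParam G k c) [DecidableEq V] :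
    ((Finset.range k).image c).card = k := by
  rw [Finset.card_image_of_injOn, Finset.card_range]
  intro i hi j hj hij
  exact (hc.inj i j hij).eq_of_lt_of_lt (by simpa using hi) (by simpa using hj)

lemma connIn_of_le (hc : IsGeodesicParam G k c) {S : Set V} {i j : ℕ} (hij : i ≤ j)
    (h : ∀ m, i ≤ m → m ≤ j → c m ∈ S) : ConnIn G S (c i) (c j) := by
  induction j, hij using Nat.le_induction with
  | base => exact .refl (h i le_rfl le_rfl)
  | succ j hij ih =>
    exact (ih fun m hm hm' => h m hm (by omega)).trans
      (.of_adj (hc.adj j) (h j hij (by omega)) (h _ (by omega) le_rfl))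

/-- A closed walk shorter than a geodesic cycle meets it only in a short arc. -/
lemma exists_arc (hc : IsGeodesicParam G k c) {b : V} (w : G.Walk b b) (hw : w.length < k)
    {S : Set V} (hS : ∀ x ∈ S, x ∈ w.support) {i : ℕ} (hi : c i ∈ S) :
    ∃ s a, 2 * a ≤ w.length ∧ ∀ r < k, c (s + r) ∈ S → r ≤ a := by
  classical
  let Q : ℕ → Prop := fun a => 2 * a ≤ k ∧ ∃ s, c s ∈ S ∧ c (s + a) ∈ S
  have hQ0 : Q 0 := ⟨by simp, i, hi, hi⟩
  have hQ : Q (Nat.findGreatest Q k) := Nat.findGreatest_spec (Nat.zero_le _) hQ0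
  have hmax : ∀ a, Q a → a ≤ Nat.findGreatest Q k := fun a ha =>
    Nat.le_findGreatest (by have := ha.1; omega) ha
  set a := Nat.findGreatest Q k
  obtain ⟨ha, s, hs, hsa⟩ := hQ
  have hrev : ∀ i d, d ≤ k → ∀ w : G.Walk (c (i + d)) (c i), min d (k - d) ≤ w.length :=
    fun i d hd w => by simpa using hc.geodesic i d hd w.reverse
  have hgeo : ∀ i d, 2 * d ≤ k → ∀ w : G.Walk (c i) (c (i + d)), d ≤ w.length :=
    fun i d hd w => by have := hc.geodesic i d (by omega) w; omega
  let W := w.rotate (c s) (hS _ hs)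
  have hWlen : W.length = w.length := Walk.length_rotate ..
  have hWS : ∀ x ∈ S, x ∈ W.support := fun x hx => (Walk.mem_support_rotate_iff ..).2 (hS x hx)
  let A := W.takeUntil _ (hWS _ hsa)
  let B := W.dropUntil _ (hWS _ hsa)
  have hAB : A.append B = W := W.take_spec _
  have hABlen : A.length + B.length = w.length := by
    rw [← hWlen, ← hAB, Walk.length_append]
  have hA : a ≤ A.length := hgeo s a ha A
  have hB : a ≤ B.length := by have := hrev s a (by omega) B; omega
  refine ⟨s, a, by omega, fun r hr hrS => ?_⟩
  by_contra! har
  have hk2 : k < 2 * r := by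
    by_contra! h
    exact absurd (hmax r ⟨h, s, hs, hrS⟩) (by omega)
  have hra : 2 * (r - a) ≤ k := by
    by_contra! h
    have := hmax (k - r + a) ⟨by omega, s + r, hrS, by
      rwa [show s + r + (k - r + a) = s + a + k by omega, hc.periodic]⟩
    omega
  have e : s + a + (r - a) = s + r := by omega
  have hrW : c (s + r) ∈ (A.append B).support := hAB ▸ hWS _ hrS
  rcases (Walk.mem_support_append_iff A B).1 hrW with h | h
  · have h1 := hc.geodesic s r hr.le (A.takeUntil _ h)
    have h2 := hrev (s + a) (r - a) (by omega) ((A.dropUntil _ h).copy (by rw [e]) rfl)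
    have h3 := congrArg Walk.length (A.take_spec h)
    simp only [Walk.length_append, Walk.length_copy] at h2 h3
    omega
  · have h1 := hrev s r hr.le (B.dropUntil _ h)
    have h2 := hc.geodesic (s + a) (r - a) (by omega) ((B.takeUntil _ h).copy rfl (by rw [e]))
    have h3 := congrArg Walk.length (B.take_spec h)
    simp only [Walk.length_append, Walk.length_copy] at h2 h3
    omega

/-- Deleting a small vertex set `S` leaves all but few vertices of a geodesic cycle in a single
component. -/
lemma exists_exceptional [Finite V] (hc : IsGeodesicParam G k c) {ℓ : ℕ} (hℓ : GeneratesLE G ℓ)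
    (hℓ2 : 2 ≤ ℓ) (S : Finset V) (hS : ℓ * (S.card - 1) < k) :
    ∃ U : Finset V, 2 * U.card ≤ ℓ * (S.card - 1) + 2 ∧
      ∀ i j, c i ∉ U → c j ∉ U → ConnIn G (S : Set V)ᶜ (c i) (c j) := by
  classical
  induction S using Finset.strongInduction with
  | H S ih =>
    by_cases hmeet : ∃ i, c i ∈ S
    swap
    · push Not at hmeet
      refine ⟨∅, by simp, fun i j _ _ => ?_⟩
      rcases le_total i j with h | h
      · exact hc.connIn_of_le h fun m _ _ => hmeet m
      · exact (hc.connIn_of_le h fun m _ _ => hmeet m).symm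
    obtain ⟨i₀, hi₀⟩ := hmeet
    by_cases hsplit : ∀ S' ⊂ S, S'.Nonempty →
        ∃ x ∈ S', ∃ y ∈ S, y ∉ S' ∧ ∃ w : G.Walk x y, 2 * w.length ≤ ℓ
    · obtain ⟨b, w, hw, hmem⟩ := exists_closed_walk_of_not_split S ⟨_, hi₀⟩ hsplit
      obtain ⟨s, a, ha, harc⟩ := hc.exists_arc w (by omega) (S := S) hmem hi₀
      refine ⟨(Finset.range (a + 1)).image fun r => c (s + r), ?_, ?_⟩
      · have := Finset.card_image_le (s := Finset.range (a + 1)) (f := fun r => c (s + r))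
        rw [Finset.card_range] at this
        omega
      · have key : ∀ r r', r < k → r' < k → a < r → r ≤ r' →
            ConnIn G (S : Set V)ᶜ (c (s + r)) (c (s + r')) := by
          intro r r' hr hr' har hrr'
          refine hc.connIn_of_le (by omega) fun m hm hm' hmS => ?_
          obtain ⟨t, rfl⟩ := Nat.exists_eq_add_of_le (show s ≤ m by omega)
          have := harc t (by omega) hmS
          omega
        intro i j hi hj
        obtain ⟨r, hr, hri⟩ := hc.exists_shift s i
        obtain ⟨r', hr', hrj⟩ := hc.exists_shift s j
        rw [hri] at hi ⊢
        rw [hrj] at hj ⊢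
        have har : a < r := by
          by_contra! h
          exact hi (Finset.mem_image.2 ⟨r, Finset.mem_range.2 (by omega), rfl⟩)
        have har' : a < r' := by
          by_contra! h
          exact hj (Finset.mem_image.2 ⟨r', Finset.mem_range.2 (by omega), rfl⟩)
        rcases le_total r r' with h | h
        · exact key r r' hr hr' har h
        · exact (key r' r hr' hr har' h).symm
    · push Not at hsplit
      obtain ⟨S₁, hS₁, hne, hfar⟩ := hsplit
      have hS₂ : S \ S₁ ⊂ S := Finset.sdiff_ssubset hS₁.subset hne
      have hcard := Finset.card_sdiff_add_card_eq_card hS₁.subset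
      have hpos := hne.card_pos
      have hpos₂ := (Finset.sdiff_nonempty.2 hS₁.2).card_pos
      have hmul : ℓ * (S₁.card - 1) + ℓ * ((S \ S₁).card - 1) + ℓ = ℓ * (S.card - 1) := by
        rw [← mul_add, ← Nat.mul_succ]
        congr 1
        omega
      obtain ⟨U₁, hU₁, h₁⟩ := ih S₁ hS₁ (by omega)
      obtain ⟨U₂, hU₂, h₂⟩ := ih (S \ S₁) hS₂ (by omega)
      refine ⟨U₁ ∪ U₂, ?_, fun i j hi hj => ?_⟩
      · have := Finset.card_union_le U₁ U₂
        omega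
      · simp only [Finset.mem_union, not_or] at hi hj
        have hunion : (S : Set V) = (S₁ : Set V) ∪ ((S \ S₁ : Finset V) : Set V) := by
          rw [← Finset.coe_union, Finset.union_sdiff_of_subset hS₁.subset]
        rw [hunion]
        refine ConnIn.compl_union hℓ (fun v p _ hpl => ?_) (h₁ i j hi.1 hj.1) (h₂ i j hi.2 hj.2)
        by_contra! h
        obtain ⟨⟨x, hx, hxS⟩, y, hy, hyS⟩ := h
        simp only [Set.mem_compl_iff, not_not, Finset.mem_coe, Finset.mem_sdiff] at hxS hyS
        obtain ⟨w, hw⟩ := exists_walk_two_mul_length_le p hx hy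
        have := hfar x hxS y hyS.1 hyS.2 w
        omega

end IsGeodesicParam

section Bramble

variable {V ι : Type u} {G : SimpleGraph V} {T : SimpleGraph ι}

/-- If a walk of `G` avoids the bag at `t`, then `t` does not separate nodes whose bags contain
the ends of the walk. -/
lemma TreeDecomp.connIn_compl_singleton (td : TreeDecomp G T) {t : ι} {x y : V}
    (h : ConnIn G (td.bag t)ᶜ x y) {s s' : ι} (hs : x ∈ td.bag s) (hs' : y ∈ td.bag s') :
    ConnIn T {t}ᶜ s s' := by
  have key : ∀ {x : V} {s s' : ι}, x ∉ td.bag t → x ∈ td.bag s → x ∈ td.bag s' →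
      ConnIn T {t}ᶜ s s' := by
    intro x s s' hx hs hs'
    obtain ⟨p, hp⟩ := (td.isTree.connected.preconnected s s').exists_isPath
    refine ⟨p, fun v hv hvt => hx ?_⟩
    rw [← Set.mem_singleton_iff.1 hvt]
    exact td.bag_sep p hp v hv ⟨hs, hs'⟩
  obtain ⟨p, hp⟩ := h
  induction p generalizing s with
  | nil => exact key (hp _ (by simp)) hs hs'
  | cons hadj p ih =>
    simp only [Walk.support_cons, List.mem_cons, forall_eq_or_imp] at hp
    obtain ⟨t₁, h1, h2⟩ := td.exists_bag_adj hadj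
    exact (key hp.1 hs h1).trans (ih h2 hs' hp.2)

/-- Every tree-decomposition has a bag covering a given bramble. -/
lemma TreeDecomp.exists_bag_cover [Finite V] (td : TreeDecomp G T) (B : Set (Set V))
    (hne : ∀ X ∈ B, X.Nonempty) (hconn : ∀ X ∈ B, ∀ x ∈ X, ∀ y ∈ X, ConnIn G X x y)
    (htouch : ∀ X ∈ B, ∀ Y ∈ B, ∃ t, (X ∩ td.bag t).Nonempty ∧ (Y ∩ td.bag t).Nonempty) :
    ∃ t, ∀ X ∈ B, (X ∩ td.bag t).Nonempty := by
  classical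
  obtain ⟨r⟩ := td.isTree.connected.nonempty
  rcases B.eq_empty_or_nonempty with rfl | hB
  · exact ⟨r, by simp⟩
  have hconnT := td.isTree.connected
  have : Nonempty ι := ⟨r⟩
  have hmin : ∀ X ∈ B, ∃ t, (X ∩ td.bag t).Nonempty ∧
      ∀ t', (X ∩ td.bag t').Nonempty → T.dist r t ≤ T.dist r t' := by
    intro X hX
    obtain ⟨x, hx⟩ := hne X hX
    obtain ⟨t, ht⟩ := td.exists_bag x
    let P : Set ι := {t | (X ∩ td.bag t).Nonempty}
    have hP : P.Nonempty := ⟨t, x, hx, ht⟩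
    exact ⟨Function.argminOn (T.dist r) P hP, Function.argminOn_mem (T.dist r) P hP,
      fun t' ht' => Function.argminOn_le (T.dist r) P ht'⟩
  choose! f hf hfmin using hmin
  obtain ⟨X, hX, hmax⟩ := Set.exists_max_image B (fun X => T.dist r (f X)) B.toFinite hB
  refine ⟨f X, fun Y hY => ?_⟩
  by_contra hYX
  have hYdisj : Y ⊆ (td.bag (f X))ᶜ := fun y hy h => hYX ⟨y, hy, h⟩
  have hneq : f Y ≠ f X := fun h => hYX (h ▸ hf Y hY)
  have hdist := hmax Y hY
  have avoid : ∀ u, u ≠ f X → T.dist r u ≤ T.dist r (f X) → ConnIn T {f X}ᶜ r u := by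
    intro u hu hle
    obtain ⟨q, hq⟩ := hconnT.exists_walk_length_eq_dist r u
    refine ⟨q, fun v hv hvt => ?_⟩
    obtain rfl := Set.mem_singleton_iff.1 hvt
    have h1 := dist_le (q.takeUntil _ hv)
    have h2 := Walk.length_takeUntil_lt_length hv hu.symm
    omega
  obtain ⟨s, ⟨x, hxX, hxs⟩, y, hyY, hys⟩ := htouch X hX Y hY
  have hYs : ConnIn T {f X}ᶜ (f Y) s := by
    obtain ⟨y', hy'Y, hy'⟩ := hf Y hY
    exact td.connIn_compl_singleton ((hconn Y hY y' hy'Y y hyY).mono hYdisj) hy' hys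
  have hr : r ≠ f X := by
    intro h
    have h0 : T.dist r (f X) = 0 := by rw [← h, dist_self]
    have h1 : r = f Y := hconnT.dist_eq_zero_iff.1 (by omega)
    exact hneq (h1.symm.trans h)
  obtain ⟨q, hq⟩ := hconnT.exists_walk_length_eq_dist (f X) r
  cases q with
  | nil => exact hr rfl
  | @cons _ u _ hadj q =>
    have hlt : T.dist r u < T.dist r (f X) := by
      have h1 := dist_le q
      rw [Walk.length_cons] at hq
      rw [SimpleGraph.dist_comm, SimpleGraph.dist_comm (u := r)]
      omega
    have hXu : X ⊆ (td.bag u)ᶜ := fun z hz h =>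
      absurd (hfmin X hX u ⟨z, hz, h⟩) (by omega)
    have hXs : ConnIn T {u}ᶜ (f X) s := by
      obtain ⟨x', hx'X, hx'⟩ := hf X hX
      exact td.connIn_compl_singleton ((hconn X hX x' hx'X x hxX).mono hXu) hx' hxs
    have hus : ConnIn T {f X}ᶜ s u :=
      hYs.symm.trans ((avoid _ hneq hdist).symm.trans (avoid u hadj.ne' hlt.le))
    have hbridge := isBridge_iff_forall_walk_mem_edges.1
      (isAcyclic_iff_forall_adj_isBridge.1 td.isTree.isAcyclic hadj)
    obtain ⟨p₁, hp₁⟩ := hXs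
    obtain ⟨p₂, hp₂⟩ := hus
    have hmem := hbridge (p₁.append p₂)
    rw [Walk.edges_append, List.mem_append] at hmem
    rcases hmem with h | h
    · exact hp₁ u (p₁.snd_mem_support_of_mem_edges h) rfl
    · exact hp₂ _ (p₂.fst_mem_support_of_mem_edges h) rfl

lemma exists_treeDecomp_treewidth {V : Type u} (G : SimpleGraph V) [Finite V] :
    ∃ (ι : Type u) (T : SimpleGraph ι) (td : TreeDecomp G T),
      ∀ t, (td.bag t).ncard ≤ treewidth G + 1 := by
  refine Nat.sInf_mem (s := {k | ∃ (ι : Type u) (T : SimpleGraph ι) (td : TreeDecomp G T),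
    ∀ t, (td.bag t).ncard ≤ k + 1}) ⟨Nat.card V, PUnit, ⊥, ?_, ?_⟩
  · exact
      { isTree := .of_subsingleton
        bag := fun _ => Set.univ
        exists_bag := by simp
        exists_bag_adj := by simp
        bag_sep := by simp }
  · intro t
    exact (Set.ncard_le_card _).trans (Nat.le_succ _)

end Bramble

/-- Two sets containing at least half of the vertices of a cycle, rounded down, touch. -/
lemma IsGeodesicParam.exists_touch {V : Type u} {G : SimpleGraph V} {k : ℕ} {c : ℕ → V}
    (hc : IsGeodesicParam G k c) [DecidableEq V] {X Y : Finset V}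
    (hXc : X ⊆ (Finset.range k).image c) (hYc : Y ⊆ (Finset.range k).image c)
    (hX : k / 2 ≤ X.card) (hY : k / 2 ≤ Y.card) :
    ∃ x ∈ X, ∃ y ∈ Y, x = y ∨ G.Adj x y := by
  by_contra! h
  have h3 := hc.three_le
  have hmeet : ∀ Z ⊆ (Finset.range k).image c, k / 2 ≤ Z.card → ∃ i, c i ∈ Z := by
    intro Z hZ hcard
    obtain ⟨z, hz⟩ := Finset.card_pos.1 (show 0 < Z.card by omega)
    obtain ⟨i, -, rfl⟩ := Finset.mem_image.1 (hZ hz)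
    exact ⟨i, hz⟩
  -- Walking along the cycle from one set to the other, one leaves the first set at a vertex
  -- that lies in neither set.
  have hexit : ∀ X Y : Finset V, (∀ x ∈ X, ∀ y ∈ Y, x ≠ y ∧ ¬ G.Adj x y) → (∃ i, c i ∈ X) →
      (∃ i, c i ∈ Y) → ∃ i, c i ∈ X ∧ c (i + 1) ∉ X ∧ c (i + 1) ∉ Y := by
    rintro X Y h ⟨i, hi⟩ ⟨j, hj⟩
    obtain ⟨r, -, hr⟩ := hc.exists_shift i j
    rw [hr] at hj
    by_contra! hno
    have : ∀ m, c (i + m) ∈ X := by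
      intro m
      induction m with
      | zero => exact hi
      | succ m ih =>
        by_contra hm
        exact (h _ ih _ (hno (i + m) ih hm)).2 (hc.adj _)
    exact (h _ (this r) _ hj).1 rfl
  obtain ⟨i, hiX, hi1, hi2⟩ := hexit X Y h (hmeet X hXc hX) (hmeet Y hYc hY)
  obtain ⟨j, hjY, hj1, hj2⟩ := hexit Y X (fun y hy x hx =>
    ⟨(h x hx y hy).1.symm, fun e => (h x hx y hy).2 e.symm⟩) (hmeet Y hYc hY) (hmeet X hXc hX)
  have hne : c (i + 1) ≠ c (j + 1) := by
    intro he
    have hij : i ≡ j [MOD k] := Nat.ModEq.add_right_cancel' 1 (hc.inj _ _ he)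
    exact (h _ hiX _ hjY).1 (by rw [← hc.map_mod i, hij, hc.map_mod])
  have hmem : ∀ m, c m ∈ (Finset.range k).image c := fun m =>
    Finset.mem_image.2 ⟨m % k, Finset.mem_range.2 (Nat.mod_lt _ (by omega)), hc.map_mod m⟩
  have hXY : Disjoint X Y := Finset.disjoint_left.2 fun x hx hx' => (h x hx x hx').1 rfl
  have hrest : Disjoint (X ∪ Y) {c (i + 1), c (j + 1)} := by
    simp [hi1, hi2, hj1, hj2]
  have hcard := Finset.card_le_card (s := (X ∪ Y) ∪ {c (i + 1), c (j + 1)})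
    (t := (Finset.range k).image c) (Finset.union_subset (Finset.union_subset hXc hYc)
      (by simp only [Finset.insert_subset_iff, Finset.singleton_subset_iff, hmem, and_self]))
  rw [Finset.card_union_of_disjoint hrest, Finset.card_union_of_disjoint hXY,
    Finset.card_pair hne, hc.card_image] at hcard
  omega

/-- a graph containing a geodesic cycle of length `k` has
tree-width at least `k / ℓ(G)`. -/
theorem tw_ge_of_geodesic {V : Type u} [Finite V] (G : SimpleGraph V) (k : ℕ)
    (h : ∃ (v : V) (p : G.Walk v v), IsGeodesicCycle G p ∧ p.length = k) :
    (k : ℚ) / (ellGraph G : ℚ) ≤ (treewidth G : ℚ) := by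
  classical
  obtain ⟨v, p, hp, rfl⟩ := h
  obtain ⟨c, hc⟩ := hp.exists_param
  set k := p.length
  rcases Nat.eq_zero_or_pos (ellGraph G) with h0 | hpos
  · simp [h0]
  have hℓ : GeneratesLE G (ellGraph G) := Nat.sInf_mem (Nat.nonempty_of_pos_sInf hpos)
  set ℓ := ellGraph G
  have hℓ2 : 2 ≤ ℓ := by
    by_contra! hlt
    have hempty : cycleChars G ℓ = ∅ := by
      refine Set.eq_empty_of_forall_notMem ?_
      rintro _ ⟨w, q, hq, hql, -⟩
      have := hq.three_le_length
      omega
    have hzero := hℓ p hp.1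
    rw [hempty, Submodule.span_empty, Submodule.mem_bot] at hzero
    obtain ⟨e, he⟩ := List.exists_mem_of_length_pos (l := p.edges)
      (by have := hp.1.three_le_length; rw [Walk.length_edges]; omega)
    have := congrFun hzero e
    simp [walkChar, he] at this
  rw [div_le_iff₀ (by exact_mod_cast hpos)]
  norm_cast
  by_contra! hlt
  obtain ⟨ι, T, td, hbag⟩ := exists_treeDecomp_treewidth G
  set C := (Finset.range k).image c
  have h3 := hc.three_le
  obtain ⟨t, ht⟩ := td.exists_bag_cover
    {X | (∀ x ∈ X, ∀ y ∈ X, ConnIn G X x y) ∧ k / 2 ≤ (C.filter (· ∈ X)).card}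
    (fun X hX => by
      obtain ⟨x, hx⟩ := Finset.card_pos.1 (show 0 < (C.filter (· ∈ X)).card by
        have := hX.2; omega)
      exact ⟨x, (Finset.mem_filter.1 hx).2⟩)
    (fun X hX => hX.1)
    (fun X hX Y hY => by
      obtain ⟨x, hx, y, hy, hxy⟩ := hc.exists_touch (Finset.filter_subset _ _)
        (Finset.filter_subset _ _) hX.2 hY.2
      have hx' := (Finset.mem_filter.1 hx).2
      have hy' := (Finset.mem_filter.1 hy).2
      rcases hxy with rfl | hxy
      · obtain ⟨t, ht⟩ := td.exists_bag x
        exact ⟨t, ⟨x, hx', ht⟩, x, hy', ht⟩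
      · obtain ⟨t, ht, ht'⟩ := td.exists_bag_adj hxy
        exact ⟨t, ⟨x, hx', ht⟩, y, hy', ht'⟩)
  obtain ⟨S, hS⟩ := (td.bag t).toFinite.exists_finset_coe
  have hcard : S.card ≤ treewidth G + 1 := by
    have := hbag t
    rwa [← hS, Set.ncard_coe_finset] at this
  have hmul : ℓ * (S.card - 1) < k :=
    (Nat.mul_le_mul_left ℓ (show S.card - 1 ≤ treewidth G by omega)).trans_lt
      (by rwa [mul_comm])
  obtain ⟨U, hU, hconn⟩ := hc.exists_exceptional hℓ hℓ2 S hmul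
  have hCU : k / 2 ≤ (C \ U).card := by
    have h1 : C.card = k := hc.card_image
    have h2 := Finset.le_card_sdiff U C
    omega
  obtain ⟨a, ha⟩ := Finset.card_pos.1 (show 0 < (C \ U).card by omega)
  obtain ⟨haC, haU⟩ := Finset.mem_sdiff.1 ha
  obtain ⟨i, -, rfl⟩ := Finset.mem_image.1 haC
  have hsub : C \ U ⊆ C.filter (· ∈ {v | ConnIn G (S : Set V)ᶜ (c i) v}) := by
    intro y hy
    obtain ⟨hyC, hyU⟩ := Finset.mem_sdiff.1 hy
    obtain ⟨j, -, rfl⟩ := Finset.mem_image.1 hyC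
    exact Finset.mem_filter.2 ⟨hyC, hconn i j haU hyU⟩
  obtain ⟨x, hx, hxt⟩ := ht _ ⟨ConnIn.component (c i), hCU.trans (Finset.card_le_card hsub)⟩
  exact hx.right_mem (hS ▸ hxt)
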